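/- arXiv:0902.3503 — 11 statements merged into one kernel-verified Lean document; each statement's English description precedes it below -/
import Mathlib

section
/- For any two words w₁, w₂ over Σ and any nonempty word x that is a common subword of w₁ and w₂, GSCO_x(w₁,w₂) ⊆ ⋃_{a} GSCO_a(w₁,w₂), where the union is over all symbols a ∈ Σ that occur in x. (That is, every word generated by a string-overlapping crossover of w₁ and w₂ is also generated by a symbol-overlapping crossover over some symbol occurring in the overlap string.) -/
/-- `x` is a factor (subword) of `w`. -/
def IsFactor {α : Type*} (x w : List α) : Prop := ∃ u v, w = u ++ x ++ v

/-- `GSCO_x(w₁,w₂)`: the crossover of `w₁` and `w₂` over the overlap word `x`. -/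
def gscoX {α : Type*} (x w₁ w₂ : List α) : Set (List α) :=
  {w | ∃ u₁ v₁ u₂ v₂, w₁ = u₁ ++ x ++ v₁ ∧ w₂ = u₂ ++ x ++ v₂ ∧
        (w = u₁ ++ x ++ v₂ ∨ w = u₂ ++ x ++ v₁)}

/-- every word generated by a string-overlapping crossover of `w₁` and `w₂`
is also generated by a symbol-overlapping crossover over some symbol occurring in `x`. -/
theorem gscoX_subset_iUnion_symbol {α : Type*} [Fintype α] (w₁ w₂ x : List α)
    (hx : x ≠ []) (hx₁ : IsFactor x w₁) (hx₂ : IsFactor x w₂) :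
    gscoX x w₁ w₂ ⊆ ⋃ a ∈ {a : α | a ∈ x}, gscoX [a] w₁ w₂ := by
  rintro w ⟨u₁, v₁, u₂, v₂, h₁, h₂, h⟩
  cases x with
  | nil => exact absurd rfl hx
  | cons a t =>
    simp only [Set.mem_iUnion]
    refine ⟨a, by simp, u₁, t ++ v₁, u₂, t ++ v₂, ?_, ?_, ?_⟩
    · simpa using h₁
    · simpa using h₂
    · simpa using h
end

section
/- For any two words w₁, w₂ over Σ, GSCO(w₁,w₂) = ⋃_{a ∈ Σ_{w₁} ∩ Σ_{w₂}} GSCO_a(w₁,w₂), where Σ_w denotes the set of symbols of Σ occurring in the word w. -/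
/-- `GSCO(w₁,w₂)`: union of `GSCO_x(w₁,w₂)` over all nonempty common subwords `x`. -/
def gsco {α : Type*} (w₁ w₂ : List α) : Set (List α) :=
  ⋃ x ∈ {x : List α | x ≠ [] ∧ IsFactor x w₁ ∧ IsFactor x w₂}, gscoX x w₁ w₂

/-- `GSCO(w₁,w₂)` equals the union of the symbol crossovers over
the symbols occurring in both `w₁` and `w₂`. -/
theorem gsco_eq_iUnion_common_symbols {α : Type*} [Fintype α] (w₁ w₂ : List α) :
    gsco w₁ w₂ = ⋃ a ∈ {a : α | a ∈ w₁ ∧ a ∈ w₂}, gscoX [a] w₁ w₂ := by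
  ext w
  simp only [gsco, Set.mem_iUnion, Set.mem_setOf_eq, exists_prop]
  constructor
  · rintro ⟨x, ⟨hx, -, -⟩, u₁, v₁, u₂, v₂, h₁, h₂, h⟩
    cases x with
    | nil => exact absurd rfl hx
    | cons a t =>
      refine ⟨a, ⟨by simp [h₁], by simp [h₂]⟩, u₁, t ++ v₁, u₂, t ++ v₂, by simp [h₁],
        by simp [h₂], ?_⟩
      simpa using h
  · rintro ⟨a, -, u₁, v₁, u₂, v₂, h₁, h₂, h⟩
    exact ⟨[a], ⟨by simp, ⟨u₁, v₁, h₁⟩, ⟨u₂, v₂, h₂⟩⟩, u₁, v₁, u₂, v₂, h₁, h₂, h⟩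
end

section
/- For any two words w₁, w₂ over Σ, GSCO(w₁,w₂) = ⋃_{a ∈ Σ} GSCO_a(w₁,w₂). -/
/-- `GSCO(w₁,w₂)` equals the union of the symbol crossovers over all
symbols of the alphabet. -/
theorem gsco_eq_iUnion_all_symbols {α : Type*} [Fintype α] (w₁ w₂ : List α) :
    gsco w₁ w₂ = ⋃ a : α, gscoX [a] w₁ w₂ := by
  ext w
  simp only [gsco, Set.mem_iUnion, Set.mem_setOf_eq, exists_prop]
  constructor
  · rintro ⟨x, ⟨hx, -, -⟩, u₁, v₁, u₂, v₂, h₁, h₂, h⟩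
    obtain ⟨a, y, rfl⟩ := List.exists_cons_of_ne_nil hx
    refine ⟨a, u₁, y ++ v₁, u₂, y ++ v₂, ?_, ?_, ?_⟩
    · simpa using h₁
    · simpa using h₂
    · simpa using h
  · rintro ⟨a, u₁, v₁, u₂, v₂, h₁, h₂, h⟩
    exact ⟨[a], ⟨by simp, ⟨u₁, v₁, h₁⟩, ⟨u₂, v₂, h₂⟩⟩, u₁, v₁, u₂, v₂, h₁, h₂, h⟩
end

section
/- For any three words w₁, w₂, w₃ over Σ and any nonempty word x, the operation 1GSCO_x is associative: 1GSCO_x(1GSCO_x({w₁},{w₂}), {w₃}) = 1GSCO_x({w₁}, 1GSCO_x({w₂},{w₃})). -/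
/-- `1GSCO_x(w₁,w₂)`: the one-output crossover of words. -/
def oneGscoX {α : Type*} (x w₁ w₂ : List α) : Set (List α) :=
  {w | ∃ u₁ v₁ u₂ v₂, w₁ = u₁ ++ x ++ v₁ ∧ w₂ = u₂ ++ x ++ v₂ ∧ w = u₁ ++ x ++ v₂}

/-- `1GSCO_x(L₁,L₂)`: the one-output crossover of languages. -/
def oneGscoXL {α : Type*} (x : List α) (L₁ L₂ : Set (List α)) : Set (List α) :=
  ⋃ w₁ ∈ L₁, ⋃ w₂ ∈ L₂, oneGscoX x w₁ w₂

theorem gsco_key {α : Type*} {s x d q : List α} (h : s ++ (x ++ d) = x ++ q) :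
    ∃ t, s ++ x = x ++ t ∧ q = t ++ d := by
  have h1 : x <+: s ++ x := by
    apply List.prefix_of_prefix_length_le (l₃ := x ++ q)
    · exact List.prefix_append _ _
    · exact ⟨d, by simpa using h⟩
    · simp
  obtain ⟨t, ht⟩ := h1
  refine ⟨t, ht.symm, ?_⟩
  rw [← List.append_assoc, ← ht, List.append_assoc] at h
  exact (List.append_cancel_left h).symm

/-- `1GSCO_x` is associative on words. -/
theorem oneGscoX_assoc {α : Type*} [Fintype α] (w₁ w₂ w₃ x : List α) (hx : x ≠ []) :
    oneGscoXL x (oneGscoXL x {w₁} {w₂}) {w₃} =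
      oneGscoXL x {w₁} (oneGscoXL x {w₂} {w₃}) := by
  ext w
  simp only [oneGscoXL, oneGscoX, Set.mem_iUnion, Set.mem_singleton_iff, Set.mem_setOf_eq,
    exists_prop, exists_eq_left, List.append_assoc]
  constructor
  · rintro ⟨z, ⟨u1, v1, u2, v2, h1, h2, h3⟩, p, q, u3, v3, h4, h5, h6⟩
    rw [h3] at h4
    rcases List.append_eq_append_iff.1 h4 with ⟨s, hs, hq⟩ | ⟨s, hs, hq⟩
    · obtain ⟨t, ht, hv⟩ := gsco_key hq.symm
      refine ⟨u2 ++ (s ++ (x ++ v3)), ⟨u2 ++ s, q, u3, v3, ?_, h5, by simp⟩,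
        u1, v1, u2, t ++ v3, h1, ?_, ?_⟩
      · rw [h2, hq]; simp
      · rw [← List.append_assoc s, ht]; simp
      · rw [h6, hs, ← List.append_assoc x, ← ht]; simp
    · obtain ⟨t, ht, hv⟩ := gsco_key hq.symm
      refine ⟨u2 ++ (x ++ v3), ⟨u2, v2, u3, v3, h2, h5, rfl⟩, p, t ++ v1, u2, v3, ?_, rfl, h6⟩
      rw [h1, hs, ← List.append_assoc x, ← ht]; simp
  · rintro ⟨y, ⟨a, b, c, d, h1, h2, h3⟩, u1, v1, p, q, h4, h5, h6⟩
    rw [h3] at h5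
    rcases List.append_eq_append_iff.1 h5 with ⟨s, hs, hq⟩ | ⟨s, hs, hq⟩
    · obtain ⟨t, ht, hv⟩ := gsco_key hq.symm
      refine ⟨u1 ++ (x ++ b), ⟨u1, v1, a, b, h4, h1, rfl⟩, u1, b, c ++ s, q, rfl, ?_, h6⟩
      rw [h2, hq]; simp
    · obtain ⟨t, ht, hv⟩ := gsco_key hq.symm
      refine ⟨u1 ++ (x ++ (t ++ b)), ⟨u1, v1, p, t ++ b, h4, ?_, rfl⟩,
        u1 ++ s, b, c, d, ?_, h2, ?_⟩
      · rw [h1, hs, ← List.append_assoc x, ← ht]; simp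
      · rw [← List.append_assoc x, ← ht]; simp
      · rw [h6, hq]; simp
end

section
/- For any three languages L₁, L₂, L₃ over Σ and any nonempty word x, 1GSCO_x(L₁, 1GSCO_x(L₂,L₃)) = 1GSCO_x(1GSCO_x(L₁,L₂), L₃). -/
theorem ov_aux {α : Type*} (x s b d : List α) (h : x ++ b = s ++ (x ++ d)) :
    ∃ t, s ++ x = x ++ t ∧ b = t ++ d := by
  have h' : x ++ b = (s ++ x) ++ d := by simpa using h
  rcases List.append_eq_append_iff.1 h' with ⟨t, h1, h2⟩ | ⟨t, h1, h2⟩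
  · exact ⟨t, h1, h2⟩
  · have hl := congrArg List.length h1
    simp at hl
    have ht : t = [] := List.length_eq_zero_iff.1 (by omega)
    have hs : s = [] := List.length_eq_zero_iff.1 (by omega)
    subst ht hs
    exact ⟨[], by simp, by simpa using h2.symm⟩

theorem ov {α : Type*} (x a b c d : List α) (h : a ++ (x ++ b) = c ++ (x ++ d)) :
    (∃ s t, c = a ++ s ∧ s ++ x = x ++ t ∧ b = t ++ d) ∨
    (∃ s t, a = c ++ s ∧ s ++ x = x ++ t ∧ d = t ++ b) := by
  rcases List.append_eq_append_iff.1 h with ⟨s, h1, h2⟩ | ⟨s, h1, h2⟩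
  · obtain ⟨t, h3, h4⟩ := ov_aux x s b d h2
    exact Or.inl ⟨s, t, h1, h3, h4⟩
  · obtain ⟨t, h3, h4⟩ := ov_aux x s d b h2
    exact Or.inr ⟨s, t, h1, h3, h4⟩

theorem mem_xl {α : Type*} (x : List α) (L₁ L₂ : Set (List α)) (w : List α) :
    w ∈ oneGscoXL x L₁ L₂ ↔ ∃ u₁ v₁ u₂ v₂, u₁ ++ (x ++ v₁) ∈ L₁ ∧ u₂ ++ (x ++ v₂) ∈ L₂ ∧
      w = u₁ ++ (x ++ v₂) := by
  simp only [oneGscoXL, oneGscoX, Set.mem_iUnion, Set.mem_setOf_eq, List.append_assoc]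
  constructor
  · rintro ⟨_, h1, _, h2, u₁, v₁, u₂, v₂, rfl, rfl, rfl⟩
    exact ⟨u₁, v₁, u₂, v₂, h1, h2, rfl⟩
  · rintro ⟨u₁, v₁, u₂, v₂, h1, h2, rfl⟩
    exact ⟨_, h1, _, h2, u₁, v₁, u₂, v₂, rfl, rfl, rfl⟩

/-- `1GSCO_x` is associative on languages. -/
theorem oneGscoXL_assoc {α : Type*} [Fintype α] (L₁ L₂ L₃ : Set (List α))
    (x : List α) (hx : x ≠ []) :
    oneGscoXL x L₁ (oneGscoXL x L₂ L₃) = oneGscoXL x (oneGscoXL x L₁ L₂) L₃ := by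
  have sw : ∀ {s t : List α}, s ++ x = x ++ t → ∀ r, s ++ (x ++ r) = x ++ (t ++ r) := by
    intro s t h r
    rw [← List.append_assoc, h, List.append_assoc]
  ext w
  rw [mem_xl, mem_xl]
  constructor
  · rintro ⟨u1, v1, p, q, h1, hz, rfl⟩
    obtain ⟨u2, v2, u3, v3, h2, h3, e⟩ := (mem_xl ..).1 hz
    rcases ov x _ _ _ _ e with ⟨s, t, rfl, hs, rfl⟩ | ⟨s, t, rfl, hs, rfl⟩
    · refine ⟨u1 ++ s, v2, u3, v3, (mem_xl ..).2 ⟨u1, v1, p, t ++ v2, h1, ?_, ?_⟩, h3, ?_⟩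
      · rw [List.append_assoc, sw hs] at h2; exact h2
      · rw [List.append_assoc, sw hs]
      · rw [List.append_assoc, sw hs]
    · refine ⟨u1, v2, u3 ++ s, q, (mem_xl ..).2 ⟨u1, v1, u2, v2, h1, h2, rfl⟩, ?_, rfl⟩
      rw [List.append_assoc, sw hs]; exact h3
  · rintro ⟨p, q, u3, v3, hy, h3, rfl⟩
    obtain ⟨u1, v1, u2, v2, h1, h2, e⟩ := (mem_xl ..).1 hy
    rcases ov x _ _ _ _ e with ⟨s, t, rfl, hs, rfl⟩ | ⟨s, t, rfl, hs, rfl⟩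
    · refine ⟨p, t ++ v1, u2, v3, ?_, (mem_xl ..).2 ⟨u2, v2, u3, v3, h2, h3, rfl⟩, rfl⟩
      rw [List.append_assoc, sw hs] at h1; exact h1
    · refine ⟨u1, v1, u2, t ++ v3, h1, (mem_xl ..).2 ⟨u2 ++ s, q, u3, v3, ?_, h3, ?_⟩, ?_⟩
      · rw [List.append_assoc, sw hs]; exact h2
      · rw [List.append_assoc, sw hs]
      · rw [List.append_assoc, sw hs]
end

section
/- Let L be a language over Σ and x a nonempty word. For every i ≥ 0 and every word w ∈ GSCO_x^i(L), there exist s ≤ 2^i − 1 and words w⁰, w¹, …, w^s ∈ L such that w belongs to the left-nested iterated crossover GSCO_x(…GSCO_x(GSCO_x({w⁰},{w¹}),{w²})…,{w^s}) (for s = 0 this means w = w⁰ ∈ L). -/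
/-- `GSCO_x(L₁,L₂)` for languages. -/
def gscoXL {α : Type*} (x : List α) (L₁ L₂ : Set (List α)) : Set (List α) :=
  ⋃ w₁ ∈ L₁, ⋃ w₂ ∈ L₂, gscoX x w₁ w₂

/-- The iterated crossover `GSCO_x^i(L)`. -/
def gscoXIter {α : Type*} (x : List α) (L : Set (List α)) : ℕ → Set (List α)
  | 0 => L
  | i + 1 => gscoXIter x L i ∪ gscoXL x (gscoXIter x L i) (gscoXIter x L i)

/-- The left-nested iterated crossover
`GSCO_x(…GSCO_x(GSCO_x({w⁰},{w¹}),{w²})…,{w^k})`. -/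
def leftNest {α : Type*} (x : List α) (ws : ℕ → List α) : ℕ → Set (List α)
  | 0 => {ws 0}
  | k + 1 => gscoXL x (leftNest x ws k) {ws (k + 1)}

theorem split_aux {α : Type*} (x u v p q : List α) (t : List α)
    (hp : p = u ++ t) (h : x ++ v = t ++ (x ++ q)) :
    ∃ r t, v = r ++ q ∧ x ++ r = t ++ x ∧ p = u ++ t := by
  rw [← List.append_assoc, List.append_eq_append_iff] at h
  rcases h with ⟨r, h1, h2⟩ | ⟨c, h1, h2⟩
  · exact ⟨r, t, h2, h1.symm, hp⟩
  · have hl := congrArg List.length h1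
    simp only [List.length_append] at hl
    have ht : t = [] := List.length_eq_zero_iff.1 (by omega)
    have hc : c = [] := List.length_eq_zero_iff.1 (by omega)
    subst ht hc
    exact ⟨[], [], by simpa using h2.symm, by simp, hp⟩

theorem split_main {α : Type*} (x u v p q : List α)
    (h : u ++ (x ++ v) = p ++ (x ++ q)) :
    (∃ r t, v = r ++ q ∧ x ++ r = t ++ x ∧ p = u ++ t) ∨
    (∃ r t, q = r ++ v ∧ x ++ r = t ++ x ∧ u = p ++ t) := by
  rw [List.append_eq_append_iff] at h
  rcases h with ⟨t, h1, h2⟩ | ⟨t, h1, h2⟩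
  · exact Or.inl (split_aux x u v p q t h1 h2)
  · exact Or.inr (split_aux x p q u v t h1 h2)

/-- Words with a linear derivation of exactly `s` crossovers. -/
inductive LinD {α : Type*} (x : List α) (L : Set (List α)) : ℕ → List α → Prop
  | base (w : List α) (h : w ∈ L) : LinD x L 0 w
  | left (s : ℕ) (u v p q : List α) (h : LinD x L s (u ++ (x ++ v)))
      (hz : p ++ (x ++ q) ∈ L) : LinD x L (s + 1) (u ++ (x ++ q))
  | right (s : ℕ) (u v p q : List α) (h : LinD x L s (u ++ (x ++ v)))
      (hz : p ++ (x ++ q) ∈ L) : LinD x L (s + 1) (p ++ (x ++ v))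

theorem leftNest_congr {α : Type*} (x : List α) (ws ws' : ℕ → List α) (s : ℕ)
    (h : ∀ k ≤ s, ws k = ws' k) : leftNest x ws s = leftNest x ws' s := by
  induction s with
  | zero => simp [leftNest, h 0]
  | succ s ih =>
    simp only [leftNest]
    rw [ih (fun k hk => h k (by omega)), h (s + 1) le_rfl]

theorem nest_step {α : Type*} (x : List α) (L : Set (List α)) (s : ℕ) (w z w' : List α)
    (hz : z ∈ L) (hw' : w' ∈ gscoX x w z)
    (h : ∃ ws : ℕ → List α, (∀ k ≤ s, ws k ∈ L) ∧ w ∈ leftNest x ws s) :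
    ∃ ws : ℕ → List α, (∀ k ≤ s + 1, ws k ∈ L) ∧ w' ∈ leftNest x ws (s + 1) := by
  obtain ⟨ws, h1, h2⟩ := h
  refine ⟨fun k => if k ≤ s then ws k else z, ?_, ?_⟩
  · intro k hk
    dsimp only
    split_ifs with hks
    · exact h1 k hks
    · exact hz
  · simp only [leftNest, gscoXL, Set.mem_iUnion]
    refine ⟨w, ?_, z, ?_, hw'⟩
    · rw [leftNest_congr x _ ws s]
      · exact h2
      · intro k hk
        simp [hk]
    · simp

theorem LinD.nest {α : Type*} {x : List α} {L : Set (List α)} {s : ℕ} {w : List α}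
    (h : LinD x L s w) :
    ∃ ws : ℕ → List α, (∀ k ≤ s, ws k ∈ L) ∧ w ∈ leftNest x ws s := by
  induction h with
  | base w h => exact ⟨fun _ => w, fun _ _ => h, by simp [leftNest]⟩
  | left s u v p q h hz ih =>
    exact nest_step x L s _ _ _ hz ⟨u, v, p, q, by simp, by simp, Or.inl (by simp)⟩ ih
  | right s u v p q h hz ih =>
    exact nest_step x L s _ _ _ hz ⟨u, v, p, q, by simp, by simp, Or.inr (by simp)⟩ ih

/-- Linear derivation with at most `n` crossovers. -/
def LinB {α : Type*} (x : List α) (L : Set (List α)) (n : ℕ) (w : List α) : Prop :=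
  ∃ s ≤ n, LinD x L s w

theorem LinB.mono {α : Type*} {x : List α} {L : Set (List α)} {m n : ℕ} {w : List α}
    (h : LinB x L m w) (hmn : m ≤ n) : LinB x L n w := by
  obtain ⟨s, hs, h⟩ := h
  exact ⟨s, hs.trans hmn, h⟩

theorem LinB.step {α : Type*} {x : List α} {L : Set (List α)} {m : ℕ} {u v p q : List α}
    (h : LinB x L m (u ++ (x ++ v))) (hz : p ++ (x ++ q) ∈ L) :
    LinB x L (m + 1) (u ++ (x ++ q)) ∧ LinB x L (m + 1) (p ++ (x ++ v)) := by
  obtain ⟨s, hs, h⟩ := h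
  exact ⟨⟨s + 1, by omega, .left s u v p q h hz⟩, ⟨s + 1, by omega, .right s u v p q h hz⟩⟩

theorem LinD.cross {α : Type*} {x : List α} {L : Set (List α)} {n : ℕ} {w : List α}
    (h : LinD x L n w) : ∀ m u₁ v₁ u₂ v₂, LinB x L m (u₁ ++ (x ++ v₁)) →
      w = u₂ ++ (x ++ v₂) →
      LinB x L (m + n + 1) (u₁ ++ (x ++ v₂)) ∧ LinB x L (m + n + 1) (u₂ ++ (x ++ v₁)) := by
  induction h with
  | base w h =>
    rintro m u₁ v₁ u₂ v₂ hB rfl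
    exact hB.step h
  | left s p q' p' q h hz ih =>
    intro m u₁ v₁ u₂ v₂ hB e
    rcases split_main _ _ _ _ _ e with ⟨r, t, rfl, hrt, rfl⟩ | ⟨r, t, rfl, hrt, rfl⟩
    · -- u₂ = p ++ t, q = r ++ v₂
      have e1 : ∀ y, x ++ (r ++ y) = t ++ (x ++ y) := fun y => by
        rw [← List.append_assoc, hrt, List.append_assoc]
      have hz' : (p' ++ t) ++ (x ++ v₂) ∈ L := by
        rw [List.append_assoc, ← e1]; exact hz
      have h1 := hB.step hz'
      refine ⟨h1.1.mono (by omega), ?_⟩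
      have h2 := h1.2
      rw [List.append_assoc, ← e1] at h2
      have h3 := (ih _ _ _ _ _ h2 rfl).2
      rw [List.append_assoc, ← e1]
      exact h3.mono (by omega)
    · -- p = u₂ ++ t, v₂ = r ++ q
      have e1 : ∀ y, x ++ (r ++ y) = t ++ (x ++ y) := fun y => by
        rw [← List.append_assoc, hrt, List.append_assoc]
      have h1 := ih m u₁ v₁ u₂ (r ++ q') hB (by rw [e1, List.append_assoc])
      refine ⟨?_, h1.2.mono (by omega)⟩
      have h2 := h1.1
      rw [e1, ← List.append_assoc] at h2
      have h3 := (h2.step hz).1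
      rw [e1, ← List.append_assoc]
      exact h3.mono (by omega)
  | right s p' q p q' h hz ih =>
    intro m u₁ v₁ u₂ v₂ hB e
    rcases split_main _ _ _ _ _ e with ⟨r, t, rfl, hrt, rfl⟩ | ⟨r, t, rfl, hrt, rfl⟩
    · have e1 : ∀ y, x ++ (r ++ y) = t ++ (x ++ y) := fun y => by
        rw [← List.append_assoc, hrt, List.append_assoc]
      have h1 := ih m u₁ v₁ (p' ++ t) v₂ hB (by rw [e1, List.append_assoc])
      refine ⟨h1.1.mono (by omega), ?_⟩
      have h2 := h1.2
      rw [List.append_assoc, ← e1] at h2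
      have h3 := (h2.step hz).2
      rw [List.append_assoc, ← e1]
      exact h3.mono (by omega)
    · have e1 : ∀ y, x ++ (r ++ y) = t ++ (x ++ y) := fun y => by
        rw [← List.append_assoc, hrt, List.append_assoc]
      have hz' : u₂ ++ (x ++ (r ++ q')) ∈ L := by
        rw [e1, ← List.append_assoc]; exact hz
      have h1 := hB.step hz'
      refine ⟨?_, h1.2.mono (by omega)⟩
      have h2 := h1.1
      rw [e1, ← List.append_assoc] at h2
      have h3 := (ih _ _ _ _ _ h2 rfl).1
      rw [e1, ← List.append_assoc]
      exact h3.mono (by omega)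

theorem iter_linB {α : Type*} (L : Set (List α)) (x : List α) (i : ℕ) :
    ∀ w ∈ gscoXIter x L i, LinB x L (2 ^ i - 1) w := by
  induction i with
  | zero => exact fun w hw => ⟨0, by simp, .base w hw⟩
  | succ i ih =>
    have hpos : 0 < 2 ^ i := by positivity
    have hpow : 2 ^ (i + 1) = 2 * 2 ^ i := by ring
    rintro w (hw | hw)
    · exact (ih w hw).mono (by omega)
    · simp only [gscoXL, Set.mem_iUnion] at hw
      obtain ⟨w₁, h₁, w₂, h₂, u₁, v₁, u₂, v₂, rfl, rfl, h⟩ := hw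
      have b₁ := ih _ h₁
      obtain ⟨s, hs, b₂⟩ := ih _ h₂
      simp only [List.append_assoc] at b₁ b₂ h
      have hc := b₂.cross _ _ _ _ _ b₁ rfl
      rcases h with rfl | rfl
      · exact hc.1.mono (by omega)
      · exact hc.2.mono (by omega)

/-- every word of `GSCO_x^i(L)` lies in a left-nested crossover of at
most `2^i` words of `L`. -/
theorem gscoXIter_mem_leftNest {α : Type*} [Fintype α] (L : Set (List α))
    (x : List α) (hx : x ≠ []) (i : ℕ) (w : List α) (hw : w ∈ gscoXIter x L i) :
    ∃ s ≤ 2 ^ i - 1, ∃ ws : ℕ → List α,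
      (∀ k ≤ s, ws k ∈ L) ∧ w ∈ leftNest x ws s := by
  obtain ⟨s, hs, h⟩ := iter_linB L x i w hw
  exact ⟨s, hs, h.nest⟩
end

section
/- Let L be a language over Σ and x a nonempty word. For every i ≥ 0 and every word w ∈ 1GSCO_x^i(L) such that x is a subword of w, there exists j ≥ 0 such that w ∈ 1GSCO_x(1GSCO_x^j(L), L). -/
/-- The iterated crossover `1GSCO_x^i(L)`. -/
def oneGscoXIter {α : Type*} (x : List α) (L : Set (List α)) : ℕ → Set (List α)
  | 0 => L
  | i + 1 => oneGscoXIter x L i ∪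
      oneGscoXL x (oneGscoXIter x L i) (oneGscoXIter x L i)

theorem mem_oneGscoXL_iff' {α : Type*} (x : List α) (L₁ L₂ : Set (List α)) (w : List α) :
    w ∈ oneGscoXL x L₁ L₂ ↔ ∃ u₁ v₁ u₂ v₂, u₁ ++ x ++ v₁ ∈ L₁ ∧ u₂ ++ x ++ v₂ ∈ L₂ ∧
      w = u₁ ++ x ++ v₂ := by
  simp only [oneGscoXL, oneGscoX, Set.mem_iUnion, Set.mem_setOf_eq]
  constructor
  · rintro ⟨w₁, h₁, w₂, h₂, u₁, v₁, u₂, v₂, rfl, rfl, rfl⟩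
    exact ⟨u₁, v₁, u₂, v₂, h₁, h₂, rfl⟩
  · rintro ⟨u₁, v₁, u₂, v₂, h₁, h₂, rfl⟩
    exact ⟨_, h₁, _, h₂, u₁, v₁, u₂, v₂, rfl, rfl, rfl⟩

theorem oneGscoXIter_mono' {α : Type*} (x : List α) (L : Set (List α)) :
    Monotone (oneGscoXIter x L) :=
  monotone_nat_of_le_succ fun _ _ h => Or.inl h

/-- every word of `1GSCO_x^i(L)` containing `x` as a subword lies in
`1GSCO_x(1GSCO_x^j(L), L)` for some `j`. -/
theorem oneGscoXIter_mem_restricted {α : Type*} [Fintype α] (L : Set (List α))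
    (x : List α) (hx : x ≠ []) (i : ℕ) (w : List α)
    (hw : w ∈ oneGscoXIter x L i) (hfac : IsFactor x w) :
    ∃ j : ℕ, w ∈ oneGscoXL x (oneGscoXIter x L j) L := by
  induction i generalizing w with
  | zero =>
    obtain ⟨u, v, rfl⟩ := hfac
    exact ⟨0, (mem_oneGscoXL_iff' _ _ _ _).2 ⟨u, v, u, v, hw, hw, rfl⟩⟩
  | succ i ih =>
    rcases hw with hw | hw
    · exact ih w hw hfac
    obtain ⟨u₁, v₁, u₂, v₂, h₁, h₂, rfl⟩ := (mem_oneGscoXL_iff' _ _ _ _).1 hw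
    obtain ⟨j, hj⟩ := ih _ h₂ ⟨u₂, v₂, rfl⟩
    obtain ⟨p, r, s, q, hp, hs, he⟩ := (mem_oneGscoXL_iff' _ _ _ _).1 hj
    rw [List.append_assoc, List.append_assoc, List.append_eq_append_iff] at he
    rcases he with ⟨t, rfl, ht⟩ | ⟨t, rfl, ht⟩
    · have hpre : x <+: t ++ x := by
        apply List.prefix_of_prefix_length_le (l₃ := x ++ v₂) ⟨v₂, rfl⟩ ⟨q, by simp [ht]⟩
        simp
      obtain ⟨s', hs'⟩ := hpre
      refine ⟨max i j + 1, (mem_oneGscoXL_iff' _ _ _ _).2 ⟨u₁ ++ t, r, s, q, Or.inr ?_, hs, ?_⟩⟩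
      · refine (mem_oneGscoXL_iff' _ _ _ _).2 ⟨u₁, v₁, u₂, s' ++ r,
          oneGscoXIter_mono' x L (le_max_left i j) h₁,
          oneGscoXIter_mono' x L (le_max_right i j) ?_, ?_⟩
        · have : u₂ ++ x ++ (s' ++ r) = u₂ ++ t ++ x ++ r := by
            calc _ = u₂ ++ (x ++ s') ++ r := by simp
              _ = _ := by rw [hs']; simp
          rw [this]; exact hp
        · symm
          calc _ = u₁ ++ (x ++ s') ++ r := by simp
            _ = _ := by rw [hs']; simp
      · simp [ht]
    · refine ⟨i, (mem_oneGscoXL_iff' _ _ _ _).2 ⟨u₁, v₁, s ++ t, v₂, h₁, ?_, rfl⟩⟩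
      have : s ++ t ++ x ++ v₂ = s ++ x ++ q := by simp [ht]
      rw [this]; exact hs
end

section
/- For every language L over Σ, the restricted and unrestricted iterated one-output crossover closures coincide: ⋃_{i≥0} r1GSCO^i(L) = ⋃_{i≥0} u1GSCO^i(L), where u1GSCO⁰(L) = L, u1GSCO^{i+1}(L) = u1GSCO^i(L) ∪ 1GSCO(u1GSCO^i(L), u1GSCO^i(L)), and r1GSCO⁰(L) = L, r1GSCO^{i+1}(L) = 1GSCO(r1GSCO^i(L), L). -/
/-- `1GSCO(w₁,w₂)`: the all-symbol one-output crossover of words. -/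
def oneGscoW {α : Type*} (w₁ w₂ : List α) : Set (List α) :=
  ⋃ a : α, oneGscoX [a] w₁ w₂

/-- `1GSCO(L₁,L₂)` for languages. -/
def oneGscoL {α : Type*} (L₁ L₂ : Set (List α)) : Set (List α) :=
  ⋃ w₁ ∈ L₁, ⋃ w₂ ∈ L₂, oneGscoW w₁ w₂

/-- `u1GSCO^i(L)`: the unrestricted iterated one-output crossover. -/
def uOneGscoIter {α : Type*} (L : Set (List α)) : ℕ → Set (List α)
  | 0 => L
  | i + 1 => uOneGscoIter L i ∪ oneGscoL (uOneGscoIter L i) (uOneGscoIter L i)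

/-- `r1GSCO^i(L)`: the restricted iterated one-output crossover. -/
def rOneGscoIter {α : Type*} (L : Set (List α)) : ℕ → Set (List α)
  | 0 => L
  | i + 1 => oneGscoL (rOneGscoIter L i) L

theorem mem_oneGscoL_iff' {α : Type*} (A B : Set (List α)) (w : List α) :
    w ∈ oneGscoL A B ↔ ∃ (a : α) (u₁ v₁ u₂ v₂ : List α),
      u₁ ++ a :: v₁ ∈ A ∧ u₂ ++ a :: v₂ ∈ B ∧ w = u₁ ++ a :: v₂ := by
  simp only [oneGscoL, oneGscoW, oneGscoX, Set.mem_iUnion, Set.mem_setOf_eq, exists_prop]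
  constructor
  · rintro ⟨w₁, h₁, w₂, h₂, a, u₁, v₁, u₂, v₂, rfl, rfl, rfl⟩
    exact ⟨a, u₁, v₁, u₂, v₂, by simpa using h₁, by simpa using h₂, by simp⟩
  · rintro ⟨a, u₁, v₁, u₂, v₂, h₁, h₂, rfl⟩
    exact ⟨_, h₁, _, h₂, a, u₁, v₁, u₂, v₂, by simp, by simp, by simp⟩

theorem rIter_step {α : Type*} (L : Set (List α)) (a : α) (u₁ v₁ u₂ v₂ : List α)
    (h₁ : ∃ j, u₁ ++ a :: v₁ ∈ rOneGscoIter L j) (h₂ : u₂ ++ a :: v₂ ∈ L) :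
    ∃ j, u₁ ++ a :: v₂ ∈ rOneGscoIter L j := by
  obtain ⟨j, hj⟩ := h₁
  exact ⟨j + 1, (mem_oneGscoL_iff' _ _ _).2 ⟨a, u₁, v₁, u₂, v₂, hj, h₂, rfl⟩⟩

theorem rIter_closed {α : Type*} (L : Set (List α)) (i : ℕ) :
    ∀ (a : α) (u₁ v₁ u₂ v₂ : List α), (∃ j, u₁ ++ a :: v₁ ∈ rOneGscoIter L j) →
      u₂ ++ a :: v₂ ∈ rOneGscoIter L i → ∃ j, u₁ ++ a :: v₂ ∈ rOneGscoIter L j := by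
  induction i with
  | zero => exact fun a u₁ v₁ u₂ v₂ h₁ h₂ => rIter_step L a u₁ v₁ u₂ v₂ h₁ h₂
  | succ i ih =>
    intro a u₁ v₁ u₂ v₂ h₁ h₂
    obtain ⟨b, p, s, t, q, hp, hq, e⟩ := (mem_oneGscoL_iff' _ _ _).1 h₂
    rcases List.append_eq_append_iff.1 e with ⟨m, rfl, e'⟩ | ⟨m, rfl, e'⟩
    · rcases m with _ | ⟨c, m⟩
      · simp only [List.nil_append, List.cons.injEq] at e'
        obtain ⟨rfl, rfl⟩ := e'
        exact rIter_step L _ u₁ v₁ t _ h₁ hq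
      · simp only [List.cons_append, List.cons.injEq] at e'
        obtain ⟨rfl, rfl⟩ := e'
        have h := ih a u₁ v₁ u₂ (m ++ b :: s) h₁ (by simpa using hp)
        have := rIter_step L b (u₁ ++ a :: m) s t q (by simpa using h) hq
        simpa using this
    · rcases m with _ | ⟨c, m⟩
      · simp only [List.nil_append, List.cons.injEq] at e'
        obtain ⟨rfl, rfl⟩ := e'
        exact rIter_step L _ u₁ v₁ t _ h₁ hq
      · simp only [List.cons_append, List.cons.injEq] at e'
        obtain ⟨rfl, rfl⟩ := e'
        exact rIter_step L a u₁ v₁ (t ++ b :: m) v₂ h₁ (by simpa using hq)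

theorem uIter_sub {α : Type*} (L : Set (List α)) (i : ℕ) :
    ∀ w ∈ uOneGscoIter L i, ∃ j, w ∈ rOneGscoIter L j := by
  induction i with
  | zero => exact fun w hw => ⟨0, hw⟩
  | succ i ih =>
    rintro w (hw | hw)
    · exact ih w hw
    · obtain ⟨a, u₁, v₁, u₂, v₂, h₁, h₂, rfl⟩ := (mem_oneGscoL_iff' _ _ _).1 hw
      obtain ⟨k, hk⟩ := ih _ h₂
      exact rIter_closed L k a u₁ v₁ u₂ v₂ (ih _ h₁) hk

theorem base_sub_uIter {α : Type*} (L : Set (List α)) (i : ℕ) : L ⊆ uOneGscoIter L i := by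
  induction i with
  | zero => exact fun w hw => hw
  | succ i ih => exact fun w hw => Or.inl (ih hw)

theorem rIter_sub {α : Type*} (L : Set (List α)) (i : ℕ) :
    rOneGscoIter L i ⊆ uOneGscoIter L i := by
  induction i with
  | zero => exact fun w hw => hw
  | succ i ih =>
    intro w hw
    obtain ⟨a, u₁, v₁, u₂, v₂, h₁, h₂, rfl⟩ := (mem_oneGscoL_iff' _ _ _).1 hw
    exact Or.inr ((mem_oneGscoL_iff' _ _ _).2
      ⟨a, u₁, v₁, u₂, v₂, ih h₁, base_sub_uIter L i h₂, rfl⟩)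

/-- the restricted and unrestricted iterated one-output crossover
closures coincide. -/
theorem rOneGscoStar_eq_uOneGscoStar {α : Type*} [Fintype α] (L : Set (List α)) :
    (⋃ i : ℕ, rOneGscoIter L i) = ⋃ i : ℕ, uOneGscoIter L i := by
  ext w
  simp only [Set.mem_iUnion]
  constructor
  · rintro ⟨i, hi⟩
    exact ⟨i, rIter_sub L i hi⟩
  · rintro ⟨i, hi⟩
    exact uIter_sub L i w hi
end

section
/- For every language L over a finite alphabet Σ (L need not be regular), the iterated crossover closure GSCO*(L) is a regular language, i.e., it is recognized by some deterministic finite automaton with finitely many states. -/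
/-- `GSCO(L)` for a language `L`. -/
def gscoL {α : Type*} (L : Set (List α)) : Set (List α) :=
  ⋃ w₁ ∈ L, ⋃ w₂ ∈ L, gsco w₁ w₂

/-- `GSCO^i(L)`: the iterated crossover. -/
def gscoIter {α : Type*} (L : Set (List α)) : ℕ → Set (List α)
  | 0 => L
  | i + 1 => gscoIter L i ∪ gscoL (gscoIter L i)

/-- `GSCO*(L)`: the iterated crossover closure. -/
def gscoStar {α : Type*} (L : Set (List α)) : Set (List α) :=
  ⋃ i : ℕ, gscoIter L i

theorem gscoIter_mono' {α : Type*} (L : Set (List α)) : Monotone (gscoIter L) :=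
  monotone_nat_of_le_succ fun _ => Set.subset_union_left

theorem gscoStar_cross {α : Type*} (L : Set (List α)) (u₁ v₁ u₂ v₂ : List α) (a : α)
    (h₁ : u₁ ++ [a] ++ v₁ ∈ gscoStar L) (h₂ : u₂ ++ [a] ++ v₂ ∈ gscoStar L) :
    u₁ ++ [a] ++ v₂ ∈ gscoStar L := by
  unfold gscoStar at *
  obtain ⟨i, hi⟩ := Set.mem_iUnion.1 h₁
  obtain ⟨j, hj⟩ := Set.mem_iUnion.1 h₂
  have hi' := gscoIter_mono' L (le_max_left i j) hi
  have hj' := gscoIter_mono' L (le_max_right i j) hj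
  refine Set.mem_iUnion.2 ⟨max i j + 1, Or.inr ?_⟩
  refine Set.mem_biUnion hi' (Set.mem_biUnion hj' ?_)
  refine Set.mem_biUnion (x := [a]) ⟨by simp, ⟨u₁, v₁, rfl⟩, ⟨u₂, v₂, rfl⟩⟩ ?_
  exact ⟨u₁, v₁, u₂, v₂, rfl, rfl, Or.inl rfl⟩

/-- for every language `L` over a finite alphabet, `GSCO*(L)` is
regular, i.e. accepted by some DFA with finitely many states. -/
theorem gscoStar_regular {α : Type*} [Fintype α] (L : Set (List α)) :
    ∃ (Q : Type) (_ : Fintype Q) (M : DFA α Q),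
      ∀ w : List α, w ∈ M.accepts ↔ w ∈ gscoStar L := by
  have hreg : Language.IsRegular (T := α) (gscoStar L) := by
    apply Language.IsRegular.of_finite_range_leftQuotient
    let F : α → Language α := fun a => {v | ∃ u, u ++ [a] ++ v ∈ gscoStar L}
    refine Set.Finite.subset (s := {(∅ : Set (List α)),
      Language.leftQuotient (α := α) (gscoStar L) []} ∪ Set.range F)
      (((Set.finite_singleton _).insert _).union (Set.finite_range F)) ?_
    rintro _ ⟨w, rfl⟩
    rcases List.eq_nil_or_concat w with rfl | ⟨u, a, rfl⟩
    · exact Or.inl (Or.inr rfl)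
    · rw [List.concat_eq_append]
      by_cases h : ∃ v, u ++ [a] ++ v ∈ gscoStar L
      · obtain ⟨v, hv⟩ := h
        refine Or.inr ⟨a, ?_⟩
        refine Set.ext fun y => ⟨?_, fun hy => ⟨u, hy⟩⟩
        rintro ⟨u₂, h₂⟩
        exact gscoStar_cross L u v u₂ y a hv h₂
      · refine Or.inl (Or.inl ?_)
        refine Set.eq_empty_iff_forall_notMem.2 fun y hy => h ⟨y, hy⟩
  obtain ⟨Q, i, M, hM⟩ := hreg
  exact ⟨Q, i, M, fun w => by rw [hM]; rfl⟩
end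

section
/- A language L over Σ is a crossover language (i.e., there exists a language L' with GSCO*(L') = L) if and only if L is closed with respect to the operation GSCO, i.e., GSCO(L) ⊆ L. -/
/-- `L` is a crossover language iff `L` is closed under GSCO. -/
theorem crossover_iff_closed {α : Type*} [Fintype α] (L : Set (List α)) :
    (∃ L' : Set (List α), gscoStar L' = L) ↔ gscoL L ⊆ L := by
  constructor
  · rintro ⟨L', rfl⟩ w hw
    have hm : Monotone (gscoIter L') := monotone_nat_of_le_succ fun i => Set.subset_union_left
    unfold gscoL at hw
    simp only [Set.mem_iUnion] at hw
    obtain ⟨w₁, h₁, w₂, h₂, h⟩ := hw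
    obtain ⟨i, hi⟩ := Set.mem_iUnion.1 h₁
    obtain ⟨j, hj⟩ := Set.mem_iUnion.1 h₂
    refine Set.mem_iUnion.2 ⟨max i j + 1, Or.inr ?_⟩
    unfold gscoL
    simp only [Set.mem_iUnion]
    exact ⟨w₁, hm (le_max_left i j) hi, w₂, hm (le_max_right i j) hj, h⟩
  · intro h
    have hc : ∀ i, gscoIter L i = L := by
      intro i
      induction i with
      | zero => rfl
      | succ n ih =>
        rw [gscoIter, ih]
        exact Set.union_eq_left.2 h
    refine ⟨L, ?_⟩
    unfold gscoStar
    simp only [hc, Set.iUnion_const]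
end

section
/- A language L over Σ belongs to TSyGSCO (i.e., there exists a language L₀ with L = GSCO_R*(L₀) where R is the set of all one-letter words over Σ) if and only if L is closed with respect to the operation GSCO_a for every symbol a ∈ Σ, i.e., GSCO_a(L,L) ⊆ L for all a ∈ Σ. -/
/-- `GSCO_R(L₁,L₂)` for a set `R` of overlap words. -/
def gscoRL {α : Type*} (R : Set (List α)) (L₁ L₂ : Set (List α)) : Set (List α) :=
  ⋃ x ∈ R, gscoXL x L₁ L₂

/-- `GSCO_R^i(L)`: the iterated `R`-crossover. -/
def gscoRIter {α : Type*} (R : Set (List α)) (L : Set (List α)) : ℕ → Set (List α)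
  | 0 => L
  | i + 1 => gscoRIter R L i ∪ gscoRL R (gscoRIter R L i) (gscoRIter R L i)

/-- `GSCO_R*(L)`: the iterated `R`-crossover closure. -/
def gscoRStar {α : Type*} (R : Set (List α)) (L : Set (List α)) : Set (List α) :=
  ⋃ i : ℕ, gscoRIter R L i

/-- `L ∈ TSyGSCO` (i.e. `L = GSCO_R*(L₀)` for some `L₀`, where `R` is
the set of all one-letter words) iff `L` is closed under `GSCO_a` for every `a`. -/
theorem TSyGSCO_iff_closed {α : Type*} [Fintype α] (L : Set (List α)) :
    (∃ L₀ : Set (List α), gscoRStar {x : List α | ∃ a : α, x = [a]} L₀ = L) ↔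
      ∀ a : α, gscoXL [a] L L ⊆ L := by
  constructor
  · rintro ⟨L₀, rfl⟩ a w hw
    simp only [gscoXL, Set.mem_iUnion] at hw
    obtain ⟨w₁, h₁, w₂, h₂, h⟩ := hw
    obtain ⟨i, hi⟩ := Set.mem_iUnion.1 h₁
    obtain ⟨j, hj⟩ := Set.mem_iUnion.1 h₂
    have mono : Monotone (gscoRIter {x : List α | ∃ a : α, x = [a]} L₀) :=
      monotone_nat_of_le_succ fun n => Set.subset_union_left
    refine Set.mem_iUnion.2 ⟨max i j + 1, Or.inr ?_⟩
    simp only [gscoRL, gscoXL, Set.mem_iUnion]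
    exact ⟨[a], ⟨a, rfl⟩, w₁, mono (le_max_left i j) hi, w₂, mono (le_max_right i j) hj, h⟩
  · intro hL
    refine ⟨L, Set.Subset.antisymm (Set.iUnion_subset fun i => ?_)
      (Set.subset_iUnion (gscoRIter {x : List α | ∃ a : α, x = [a]} L) 0)⟩
    induction i with
    | zero => exact Set.Subset.rfl
    | succ n ih =>
      refine Set.union_subset ih ?_
      intro w hw
      simp only [gscoRL, gscoXL, Set.mem_iUnion] at hw
      obtain ⟨x, ⟨a, rfl⟩, w₁, h₁, w₂, h₂, h⟩ := hw
      apply hL a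
      simp only [gscoXL, Set.mem_iUnion]
      exact ⟨w₁, ih h₁, w₂, ih h₂, h⟩
end
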